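/- Let T : ℝ^d → ℝ^d be a 1-Lipschitz odd map (T(−x) = −T(x)) and let μ be the pushforward of the standard Gaussian measure γ_d by T. Then for every continuous, bounded from below, even function f : ℝ^d → ℝ, (∫ e^{−f} dμ) · (∫ e^{Hf} dμ) ≤ 1. -/

import Mathlib

open MeasureTheory Real

/-- The standard Gaussian probability measure on `ℝ^d`. -/
noncomputable def stdGauss (d : ℕ) : Measure (EuclideanSpace ℝ (Fin d)) :=
  volume.withDensity fun x =>
    ENNReal.ofReal ((2 * π) ^ (-(d : ℝ) / 2) * Real.exp (-‖x‖ ^ 2 / 2))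

/-- The quadratic infimum convolution `Hf(x) = inf_y ( f(x+y) + |y|²/2 )`. -/
noncomputable def Hconv {E : Type*} [NormedAddCommGroup E] (f : E → ℝ) (x : E) : ℝ :=
  ⨅ y : E, (f (x + y) + ‖y‖ ^ 2 / 2)

/-- One-dimensional Brunn-Minkowski inequality for compact sets. -/
lemma volume_add_le_of_isCompact {K L S : Set ℝ} (hK : IsCompact K) (hL : IsCompact L)
    (hK' : K.Nonempty) (hL' : L.Nonempty) (hS : ∀ u ∈ K, ∀ v ∈ L, u + v ∈ S) :
    volume K + volume L ≤ volume S := by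
  obtain ⟨k, hk, hkmax⟩ := hK.exists_isGreatest hK'
  obtain ⟨l, hl, hlmin⟩ := hL.exists_isLeast hL'
  have hunion : (fun x => x + -l) ⁻¹' K ∪ (fun x => x + -k) ⁻¹' L ⊆ S := by
    rintro x (hx | hx)
    · simpa using hS _ hx _ hl
    · simpa using hS _ hk _ hx
  have hdisj : AEDisjoint volume ((fun x => x + -l) ⁻¹' K) ((fun x => x + -k) ⁻¹' L) := by
    refine measure_mono_null (t := {k + l}) ?_ (by simp)
    rintro x ⟨hx1, hx2⟩
    have h1 := hkmax hx1
    have h2 := hlmin hx2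
    simp only [Set.mem_singleton_iff]
    linarith
  calc volume K + volume L
      = volume ((fun x => x + -l) ⁻¹' K) + volume ((fun x => x + -k) ⁻¹' L) := by
        rw [measure_preimage_add_right, measure_preimage_add_right]
    _ = volume ((fun x => x + -l) ⁻¹' K ∪ (fun x => x + -k) ⁻¹' L) :=
        (measure_union₀ ((hL.measurableSet.preimage (measurable_add_const _)).nullMeasurableSet)
          hdisj).symm
    _ ≤ volume S := measure_mono hunion

/-- One-dimensional Brunn-Minkowski inequality for measurable sets. -/
lemma volume_add_le_of_add_mem {A B S : Set ℝ} (hA : MeasurableSet A) (hB : MeasurableSet B)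
    (hA' : A.Nonempty) (hB' : B.Nonempty) (hS : ∀ u ∈ A, ∀ v ∈ B, u + v ∈ S) :
    volume A + volume B ≤ volume S := by
  obtain ⟨a, ha⟩ := hA'
  obtain ⟨b, hb⟩ := hB'
  have key : ∀ K L : Set ℝ, K ⊆ A → IsCompact K → L ⊆ B → IsCompact L →
      volume K + volume L ≤ volume S := by
    intro K L hKA hK hLB hL
    refine le_trans (add_le_add (measure_mono (Set.subset_insert a K))
      (measure_mono (Set.subset_insert b L))) ?_
    exact volume_add_le_of_isCompact (hK.insert a) (hL.insert b) (Set.insert_nonempty _ _)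
      (Set.insert_nonempty _ _) fun u hu v hv =>
        hS u (Set.insert_subset ha hKA hu) v (Set.insert_subset hb hLB hv)
  rw [hA.measure_eq_iSup_isCompact volume, hB.measure_eq_iSup_isCompact volume]
  simp_rw [iSup_and']
  exact ENNReal.biSup_add_biSup_le' ⟨∅, by simp⟩ ⟨∅, by simp⟩
    fun K hK L hL => key K L hK.1 hK.2 hL.1 hL.2

/-- One-dimensional Prékopa-Leindler inequality for functions normalized to have supremum `1`. -/
lemma lintegral_add_le_of_mul_le_sq {F G h : ℝ → ℝ} (hF : Measurable F) (hG : Measurable G)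
    (hh : Measurable h) (hF0 : ∀ x, 0 ≤ F x) (hG0 : ∀ x, 0 ≤ G x) (hh0 : ∀ x, 0 ≤ h x)
    (hF1 : ∀ x, F x ≤ 1) (hG1 : ∀ x, G x ≤ 1) (hF2 : ∀ t < 1, ∃ x, t < F x)
    (hG2 : ∀ t < 1, ∃ x, t < G x) (hFG : ∀ u v, F u * G v ≤ h (u + v) ^ 2) :
    (∫⁻ x, ENNReal.ofReal (F x)) + (∫⁻ x, ENNReal.ofReal (G x)) ≤ ∫⁻ x, ENNReal.ofReal (h x) := by
  rw [lintegral_eq_lintegral_meas_lt volume (ae_of_all _ hF0) hF.aemeasurable,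
    lintegral_eq_lintegral_meas_lt volume (ae_of_all _ hG0) hG.aemeasurable,
    lintegral_eq_lintegral_meas_lt volume (ae_of_all _ hh0) hh.aemeasurable]
  rw [← lintegral_add_left']
  · refine setLIntegral_mono' measurableSet_Ioi fun t ht => ?_
    rcases lt_or_ge t 1 with h1 | h1
    · refine volume_add_le_of_add_mem (measurableSet_lt measurable_const hF)
        (measurableSet_lt measurable_const hG) (hF2 t h1) (hG2 t h1) fun u hu v hv => ?_
      have ht' : 0 < t := ht
      have hu' : t < F u := hu
      have hv' : t < G v := hv
      have : t ^ 2 < h (u + v) ^ 2 := lt_of_lt_of_le (by nlinarith) (hFG u v)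
      exact lt_of_pow_lt_pow_left₀ 2 (hh0 _) this
    · have e1 : {a | t < F a} = ∅ := by
        ext x; simpa using (hF1 x).trans h1
      have e2 : {a | t < G a} = ∅ := by
        ext x; simpa using (hG1 x).trans h1
      simp [e1, e2]
  · refine Measurable.aemeasurable ?_
    exact Antitone.measurable fun s t hst => measure_mono fun x hx => lt_of_le_of_lt hst hx

/-- One-dimensional Prékopa-Leindler inequality for bounded functions. -/
lemma four_mul_integral_mul_integral_le {F G h : ℝ → ℝ} (hF : Measurable F) (hG : Measurable G)
    (hh : Measurable h) (hF0 : ∀ x, 0 ≤ F x) (hG0 : ∀ x, 0 ≤ G x) (hh0 : ∀ x, 0 ≤ h x)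
    (hFb : BddAbove (Set.range F)) (hGb : BddAbove (Set.range G))
    (hFi : Integrable F) (hGi : Integrable G) (hhi : Integrable h)
    (hFG : ∀ u v, F u * G v ≤ h (u + v) ^ 2) :
    4 * ((∫ x, F x) * ∫ x, G x) ≤ (∫ x, h x) ^ 2 := by
  have sup_nonneg : ∀ {F : ℝ → ℝ}, (∀ x, 0 ≤ F x) → BddAbove (Set.range F) → 0 ≤ ⨆ x, F x :=
    fun h0 hb => (h0 0).trans (le_ciSup hb 0)
  have eq_zero : ∀ {F : ℝ → ℝ}, (∀ x, 0 ≤ F x) → BddAbove (Set.range F) → (⨆ x, F x) = 0 →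
      ∫ x, F x = 0 := fun {F} h0 hb he => by
    have : F = 0 := funext fun x => le_antisymm ((le_ciSup hb x).trans he.le) (h0 x)
    simp [this]
  have norm_le : ∀ {F : ℝ → ℝ}, BddAbove (Set.range F) → 0 < (⨆ x, F x) →
      ∀ x, F x / (⨆ x, F x) ≤ 1 := fun hb hp x => (div_le_one hp).2 (le_ciSup hb x)
  have norm_lt : ∀ {F : ℝ → ℝ}, 0 < (⨆ x, F x) →
      ∀ t < 1, ∃ x, t < F x / (⨆ x, F x) := fun {F} hp t ht => by
    obtain ⟨x, hx⟩ := exists_lt_of_lt_ciSup (show t * (⨆ x, F x) < ⨆ x, F x by nlinarith)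
    exact ⟨x, (lt_div_iff₀ hp).2 hx⟩
  rcases (sup_nonneg hF0 hFb).eq_or_lt' with ha | ha
  · rw [eq_zero hF0 hFb ha]; simp [sq_nonneg]
  rcases (sup_nonneg hG0 hGb).eq_or_lt' with hb | hb
  · rw [eq_zero hG0 hGb hb]; simp [sq_nonneg]
  have hFlt := norm_lt ha
  have hGlt := norm_lt hb
  have hFle := norm_le hFb ha
  have hGle := norm_le hGb hb
  set α := ⨆ x, F x
  set β := ⨆ x, G x
  have hc : 0 < √(α * β) := Real.sqrt_pos.2 (mul_pos ha hb)
  have hc2 : √(α * β) ^ 2 = α * β := Real.sq_sqrt (mul_pos ha hb).le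
  have main := lintegral_add_le_of_mul_le_sq (hF.div_const α) (hG.div_const β)
    (hh.div_const √(α * β)) (fun x => div_nonneg (hF0 x) ha.le)
    (fun x => div_nonneg (hG0 x) hb.le) (fun x => div_nonneg (hh0 x) hc.le) hFle hGle hFlt hGlt
    (fun u v => by
      rw [div_pow, hc2, div_mul_div_comm]
      exact div_le_div_of_nonneg_right (hFG u v) (mul_pos ha hb).le)
  rw [← ofReal_integral_eq_lintegral_ofReal (hFi.div_const _)
      (ae_of_all _ fun x => div_nonneg (hF0 x) ha.le),
    ← ofReal_integral_eq_lintegral_ofReal (hGi.div_const _)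
      (ae_of_all _ fun x => div_nonneg (hG0 x) hb.le),
    ← ofReal_integral_eq_lintegral_ofReal (hhi.div_const _)
      (ae_of_all _ fun x => div_nonneg (hh0 x) hc.le), integral_div, integral_div, integral_div,
    ← ENNReal.ofReal_add (div_nonneg (integral_nonneg hF0) ha.le)
      (div_nonneg (integral_nonneg hG0) hb.le),
    ENNReal.ofReal_le_ofReal_iff (div_nonneg (integral_nonneg hh0) hc.le)] at main
  have hx : 0 ≤ (∫ x, F x) / α := div_nonneg (integral_nonneg hF0) ha.le
  have hy : 0 ≤ (∫ x, G x) / β := div_nonneg (integral_nonneg hG0) hb.le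
  have hsq : 4 * ((∫ x, F x) / α * ((∫ x, G x) / β)) ≤ ((∫ x, h x) / √(α * β)) ^ 2 := by
    nlinarith [sq_nonneg ((∫ x, F x) / α - (∫ x, G x) / β)]
  rw [div_pow, hc2, div_mul_div_comm, ← mul_div_assoc] at hsq
  exact (div_le_div_iff_of_pos_right (mul_pos ha hb)).1 hsq

lemma integral_Ioi_eq_integral_exp (f : ℝ → ℝ) :
    ∫ s in Set.Ioi 0, f s = ∫ u, Real.exp u * f (Real.exp u) := by
  have := integral_image_eq_integral_abs_deriv_smul (s := Set.univ) (f := Real.exp)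
    (f' := Real.exp) MeasurableSet.univ (fun x _ => (Real.hasDerivAt_exp x).hasDerivWithinAt)
    Real.exp_injective.injOn f
  simpa [Set.image_univ, Real.range_exp, abs_of_pos (Real.exp_pos _)] using this

lemma integrable_exp_mul_comp_exp {f : ℝ → ℝ} (hf : IntegrableOn f (Set.Ioi 0)) :
    Integrable fun u => Real.exp u * f (Real.exp u) := by
  have := (integrableOn_image_iff_integrableOn_abs_deriv_smul (s := Set.univ) (f := Real.exp)
    (f' := Real.exp) MeasurableSet.univ (fun x _ => (Real.hasDerivAt_exp x).hasDerivWithinAt)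
    Real.exp_injective.injOn f).1 (by simpa [Set.image_univ, Real.range_exp] using hf)
  simpa [abs_of_pos (Real.exp_pos _)] using this

/-- The half-line functional Santaló inequality. -/
lemma integral_Ioi_mul_integral_Ioi_le {f g : ℝ → ℝ} (hf : Measurable f) (hg : Measurable g)
    (hf0 : ∀ x, 0 ≤ f x) (hg0 : ∀ x, 0 ≤ g x) (hfi : Integrable f) (hgi : Integrable g)
    (hfb : ∃ C, ∀ s, 0 < s → s * f s ≤ C) (hgb : ∃ C, ∀ s, 0 < s → s * g s ≤ C)
    {K : ℝ} (hK : 0 ≤ K) (hfg : ∀ s t, 0 < s → 0 < t → f s * g t ≤ K * Real.exp (-(s * t))) :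
    (∫ s in Set.Ioi 0, f s) * (∫ t in Set.Ioi 0, g t) ≤ K * (π / 2) := by
  let p : ℝ → ℝ := fun s => √K * Real.exp (-(1 / 2) * s ^ 2)
  let H : ℝ → ℝ := fun u => Real.exp u * p (Real.exp u)
  have hp : IntegrableOn p (Set.Ioi 0) :=
    ((integrable_exp_neg_mul_sq (by norm_num)).const_mul _).integrableOn
  have hpi : ∫ s in Set.Ioi 0, p s = √K * (√(π / (1 / 2)) / 2) := by
    rw [integral_const_mul, integral_gaussian_Ioi]
  have hH : Integrable H := integrable_exp_mul_comp_exp hp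
  have hHc : Measurable H := by fun_prop
  have hH2 : Integrable fun r => H (r / 2) := hH.comp_div two_ne_zero
  have hHi : ∫ r, H (r / 2) = 2 * (√K * (√(π / (1 / 2)) / 2)) := by
    rw [Measure.integral_comp_div, ← hpi, integral_Ioi_eq_integral_exp]
    simp [H]
  obtain ⟨C, hC⟩ := hfb
  obtain ⟨D, hD⟩ := hgb
  have main := four_mul_integral_mul_integral_le
    (F := fun u => Real.exp u * f (Real.exp u)) (G := fun u => Real.exp u * g (Real.exp u))
    (h := fun r => H (r / 2)) (by fun_prop) (by fun_prop) (by fun_prop)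
    (fun x => mul_nonneg (Real.exp_pos _).le (hf0 _))
    (fun x => mul_nonneg (Real.exp_pos _).le (hg0 _)) (fun x => by positivity)
    ⟨C, by rintro _ ⟨x, rfl⟩; exact hC _ (Real.exp_pos _)⟩
    ⟨D, by rintro _ ⟨x, rfl⟩; exact hD _ (Real.exp_pos _)⟩
    (integrable_exp_mul_comp_exp hfi.integrableOn) (integrable_exp_mul_comp_exp hgi.integrableOn)
    hH2 (fun u v => by
      have h1 := hfg _ _ (Real.exp_pos u) (Real.exp_pos v)
      have e1 : Real.exp ((u + v) / 2) ^ 2 = Real.exp u * Real.exp v := by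
        rw [← Real.exp_nat_mul, ← Real.exp_add]; congr 1; push_cast; ring
      have e2 : H ((u + v) / 2) ^ 2 =
          Real.exp u * Real.exp v * (K * Real.exp (-(Real.exp u * Real.exp v))) := by
        simp only [H, p, e1, mul_pow, Real.sq_sqrt hK]
        rw [← Real.exp_nat_mul]
        congr 3; push_cast; ring
      rw [e2]
      calc _ = Real.exp u * Real.exp v * (f (Real.exp u) * g (Real.exp v)) := by ring
        _ ≤ _ := by gcongr)
  rw [hHi, ← integral_Ioi_eq_integral_exp, ← integral_Ioi_eq_integral_exp] at main
  have e : (2 * (√K * (√(π / (1 / 2)) / 2))) ^ 2 = 4 * (K * (π / 2)) := by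
    rw [mul_pow, mul_pow, div_pow, Real.sq_sqrt hK, Real.sq_sqrt (by positivity)]; ring
  linarith

set_option linter.unusedSectionVars false

/-- Nonnegative bounded measurable functions with bounded support. -/
structure IsTame {E : Type*} [NormedAddCommGroup E] [MeasurableSpace E] (f : E → ℝ) : Prop where
  measurable : Measurable f
  nonneg : ∀ x, 0 ≤ f x
  exists_le : ∃ M, ∀ x, f x ≤ M
  exists_norm_le : ∃ R, ∀ x, f x ≠ 0 → ‖x‖ ≤ R

namespace IsTame

section

variable {E : Type*} [NormedAddCommGroup E] [NormedSpace ℝ E] [FiniteDimensional ℝ E]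
  [MeasureSpace E] [BorelSpace E]
  {F : Type*} [NormedAddCommGroup F] [NormedSpace ℝ F]

lemma mul_continuous {f h : E → ℝ} (hf : IsTame f) (hh : Continuous h) (hh0 : ∀ x, 0 ≤ h x) :
    IsTame fun x => f x * h x := by
  obtain ⟨M, hM⟩ := hf.exists_le
  obtain ⟨R, hR⟩ := hf.exists_norm_le
  obtain ⟨C, hC⟩ := (isCompact_closedBall (0 : E) R).exists_bound_of_continuousOn hh.continuousOn
  refine ⟨hf.measurable.mul hh.measurable, fun x => mul_nonneg (hf.nonneg x) (hh0 x),
    ⟨max 0 (M * C), fun x => ?_⟩, ⟨R, fun x hx => hR x (left_ne_zero_of_mul hx)⟩⟩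
  by_cases hx : f x = 0
  · simp [hx]
  · refine le_max_of_le_right ?_
    have := hC x (by simpa using hR x hx)
    exact mul_le_mul (hM x) ((le_abs_self _).trans this) (hh0 x) ((hf.nonneg x).trans (hM x))

lemma comp_homeomorph {E' : Type*} [NormedAddCommGroup E'] [NormedSpace ℝ E']
    [FiniteDimensional ℝ E'] [MeasureSpace E'] [BorelSpace E'] {f : E → ℝ} (hf : IsTame f)
    (e : E' ≃ₜ E) : IsTame fun x => f (e x) := by
  obtain ⟨M, hM⟩ := hf.exists_le
  obtain ⟨R, hR⟩ := hf.exists_norm_le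
  obtain ⟨C, hC⟩ :=
    (isCompact_closedBall (0 : E) R).exists_bound_of_continuousOn e.symm.continuous.continuousOn
  refine ⟨hf.measurable.comp e.continuous.measurable, fun x => hf.nonneg _, ⟨M, fun x => hM _⟩,
    ⟨C, fun x hx => ?_⟩⟩
  simpa using hC (e x) (by simpa using hR _ hx)

variable [IsFiniteMeasureOnCompacts (volume : Measure E)]

lemma integrable_smul {f : E → ℝ} (hf : IsTame f) {h : E → F} (hh : Continuous h) :
    Integrable fun x => f x • h x := by
  obtain ⟨M, hM⟩ := hf.exists_le
  obtain ⟨R, hR⟩ := hf.exists_norm_le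
  obtain ⟨C, hC⟩ := (isCompact_closedBall (0 : E) R).exists_bound_of_continuousOn hh.continuousOn
  have hsupp : (Function.support fun x => f x • h x) ⊆ Metric.closedBall 0 R := fun x hx => by
    simpa using hR x (left_ne_zero_of_smul hx)
  rw [← integrableOn_iff_integrable_of_support_subset hsupp]
  refine Measure.integrableOn_of_bounded (M := M * C) measure_closedBall_lt_top.ne
    (hf.measurable.aestronglyMeasurable.smul hh.aestronglyMeasurable) ?_
  refine (ae_restrict_iff' measurableSet_closedBall).2 (ae_of_all _ fun x hx => ?_)
  rw [norm_smul, Real.norm_of_nonneg (hf.nonneg x)]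
  exact mul_le_mul (hM x) (hC x hx) (norm_nonneg _) ((hf.nonneg x).trans (hM x))

lemma integrable {f : E → ℝ} (hf : IsTame f) : Integrable f := by
  simpa using hf.integrable_smul (continuous_const (y := (1 : ℝ)))

end

end IsTame

section Product

variable {E : Type*} [NormedAddCommGroup E] [NormedSpace ℝ E] [FiniteDimensional ℝ E]
  [MeasureSpace E] [BorelSpace E] [(volume : Measure E).IsAddHaarMeasure]

instance isFiniteMeasureOnCompacts_volume_real_prod :
    IsFiniteMeasureOnCompacts (volume : Measure (ℝ × E)) :=
  inferInstanceAs (IsFiniteMeasureOnCompacts ((volume : Measure ℝ).prod (volume : Measure E)))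

lemma measurableSet_fst_gt (c : ℝ) : MeasurableSet {x : ℝ × E | c < x.1} :=
  measurableSet_lt measurable_const measurable_fst

lemma measurableSet_fst_lt (c : ℝ) : MeasurableSet {x : ℝ × E | x.1 < c} :=
  measurableSet_lt measurable_fst measurable_const

lemma volume_fst_eq (c : ℝ) : volume {x : ℝ × E | x.1 = c} = 0 := by
  have : {x : ℝ × E | x.1 = c} = {c} ×ˢ Set.univ := by ext x; simp
  rw [this, Measure.volume_eq_prod, Measure.prod_prod]
  simp

/-- Integrals split along a hyperplane. -/
lemma integral_eq_setIntegral_gt_add_lt {h : ℝ × E → ℝ} (hh : Integrable h) (c : ℝ) :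
    ∫ x, h x = (∫ x in {x : ℝ × E | c < x.1}, h x) + ∫ x in {x : ℝ × E | x.1 < c}, h x := by
  rw [← integral_add_compl (measurableSet_fst_gt c) hh]
  congr 1
  refine setIntegral_congr_set ?_
  have : ∀ᵐ x : ℝ × E, x.1 ≠ c := by
    rw [ae_iff]; simpa using volume_fst_eq c
  filter_upwards [this] with x hx
  refine propext ⟨fun h1 => lt_of_le_of_ne (not_lt.1 h1) hx, fun h1 => not_lt.2 (le_of_lt h1)⟩

lemma setIntegral_fst_gt_eq {F : Type*} [NormedAddCommGroup F] [NormedSpace ℝ F]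
    {h : ℝ × E → F} (hh : Integrable h) (c : ℝ) :
    ∫ x in {x : ℝ × E | c < x.1}, h x = ∫ s in Set.Ioi c, ∫ y, h (s, y) := by
  have : {x : ℝ × E | c < x.1} = Set.Ioi c ×ˢ Set.univ := by ext x; simp
  rw [this, Measure.volume_eq_prod, setIntegral_prod _ (by exact hh.integrableOn)]
  simp

lemma setIntegral_fst_gt_eq_symm {F : Type*} [NormedAddCommGroup F] [NormedSpace ℝ F]
    {h : ℝ × E → F} (hh : Integrable h) (c : ℝ) :
    ∫ x in {x : ℝ × E | c < x.1}, h x = ∫ y, ∫ s in Set.Ioi c, h (s, y) := by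
  have : {x : ℝ × E | c < x.1} = Set.Ioi c ×ˢ Set.univ := by ext x; simp
  rw [this, Measure.volume_eq_prod, ← Measure.prod_restrict, Measure.restrict_univ,
    integral_prod_symm]
  have := hh.integrableOn (s := Set.Ioi c ×ˢ Set.univ)
  rwa [IntegrableOn, Measure.volume_eq_prod, ← Measure.prod_restrict, Measure.restrict_univ] at this

/-- The affine shear `(s, y) ↦ (c + s, a + y + s • w)`. -/
def shear (c : ℝ) (a w : E) : ℝ × E ≃ₜ ℝ × E where
  toFun x := (c + x.1, a + x.2 + x.1 • w)
  invFun x := (x.1 - c, x.2 - a - (x.1 - c) • w)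
  left_inv x := by
    refine Prod.ext (by simp) ?_
    simp only [add_sub_cancel_left]
    abel
  right_inv x := by
    refine Prod.ext (by simp) ?_
    simp only
    abel
  continuous_toFun := by fun_prop
  continuous_invFun := by fun_prop

lemma measurePreserving_shear (c : ℝ) (a w : E) :
    MeasurePreserving (shear c a w) := by
  refine MeasurePreserving.skew_product (g := fun s y => a + y + s • w)
    (measurePreserving_add_left volume c) (by fun_prop) (ae_of_all _ fun s => ?_)
  exact ((measurePreserving_add_right volume (s • w)).comp
    (measurePreserving_add_left volume a)).map_eq

lemma setIntegral_shear_gt {F : Type*} [NormedAddCommGroup F] [NormedSpace ℝ F] (c : ℝ) (a w : E)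
    (h : ℝ × E → F) :
    ∫ x in {x : ℝ × E | 0 < x.1}, h (shear c a w x) = ∫ x in {x : ℝ × E | c < x.1}, h x := by
  rw [← (measurePreserving_shear c a w).setIntegral_preimage_emb
    (shear c a w).measurableEmbedding h {x : ℝ × E | c < x.1}]
  congr 2
  ext x
  simp [shear]

lemma setIntegral_shear_lt {F : Type*} [NormedAddCommGroup F] [NormedSpace ℝ F] (c : ℝ) (a w : E)
    (h : ℝ × E → F) :
    ∫ x in {x : ℝ × E | x.1 < 0}, h (shear c a w x) = ∫ x in {x : ℝ × E | x.1 < c}, h x := by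
  rw [← (measurePreserving_shear c a w).setIntegral_preimage_emb
    (shear c a w).measurableEmbedding h {x : ℝ × E | x.1 < c}]
  congr 2
  ext x
  simp [shear]

/-- The linear shear `(t, y) ↦ (t - ℓ y, y)`. -/
def dualShear (l : E →ₗ[ℝ] ℝ) : ℝ × E ≃ₜ ℝ × E where
  toFun x := (x.1 - l x.2, x.2)
  invFun x := (x.1 + l x.2, x.2)
  left_inv x := by ext <;> simp
  right_inv x := by ext <;> simp
  continuous_toFun := by
    have := l.continuous_of_finiteDimensional
    fun_prop
  continuous_invFun := by
    have := l.continuous_of_finiteDimensional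
    fun_prop

lemma measurePreserving_dualShear (l : E →ₗ[ℝ] ℝ) : MeasurePreserving (dualShear l) := by
  have hl : Measurable l := l.continuous_of_finiteDimensional.measurable
  have h : MeasurePreserving (fun x : E × ℝ => (x.1, x.2 - l x.1))
      (volume.prod volume) (volume.prod volume) :=
    MeasurePreserving.skew_product (g := fun y t => t - l y) (MeasurePreserving.id volume)
      (by fun_prop) (ae_of_all _ fun y => (measurePreserving_sub_right volume (l y)).map_eq)
  exact (Measure.measurePreserving_swap.comp h).comp Measure.measurePreserving_swap

/-- The reflection `(s, y) ↦ (-s, y)`. -/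
def reflectFst (E : Type*) [TopologicalSpace E] : ℝ × E ≃ₜ ℝ × E :=
  (Homeomorph.neg ℝ).prodCongr (Homeomorph.refl E)

lemma measurePreserving_reflectFst : MeasurePreserving (reflectFst E) :=
  (Measure.measurePreserving_neg volume).prod (MeasurePreserving.id volume)

lemma setIntegral_fst_lt_zero_eq {F : Type*} [NormedAddCommGroup F] [NormedSpace ℝ F]
    (h : ℝ × E → F) :
    ∫ x in {x : ℝ × E | x.1 < 0}, h x = ∫ x in {x : ℝ × E | 0 < x.1}, h (reflectFst E x) := by
  rw [← measurePreserving_reflectFst.setIntegral_preimage_emb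
    (reflectFst E).measurableEmbedding]
  congr 2
  ext x
  simp [reflectFst]

namespace IsTame

lemma slice {f : ℝ × E → ℝ} (hf : IsTame f) (y : E) : IsTame fun s => f (s, y) := by
  obtain ⟨M, hM⟩ := hf.exists_le
  obtain ⟨R, hR⟩ := hf.exists_norm_le
  exact ⟨hf.measurable.comp (by fun_prop), fun s => hf.nonneg _, ⟨M, fun s => hM _⟩,
    ⟨R, fun s hs => (norm_fst_le (s, y)).trans (hR _ hs)⟩⟩

lemma integral_Ioi {f : ℝ × E → ℝ} (hf : IsTame f) :
    IsTame fun y => ∫ s in Set.Ioi 0, f (s, y) := by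
  obtain ⟨M, hM⟩ := hf.exists_le
  obtain ⟨R, hR⟩ := hf.exists_norm_le
  have hM0 : 0 ≤ M := (hf.nonneg 0).trans (hM 0)
  refine ⟨?_, fun y => integral_nonneg fun s => hf.nonneg _,
    ⟨M * volume.real (Metric.closedBall (0 : ℝ) R), fun y => ?_⟩, ⟨R, fun y hy => ?_⟩⟩
  · exact (hf.measurable.stronglyMeasurable.integral_prod_left' (μ := volume.restrict _)).measurable
  · calc ∫ s in Set.Ioi 0, f (s, y) ≤ ∫ s, f (s, y) :=
          setIntegral_le_integral (hf.slice y).integrable (ae_of_all _ fun s => hf.nonneg _)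
      _ = ∫ s in Metric.closedBall (0 : ℝ) R, f (s, y) := by
          refine (setIntegral_eq_integral_of_forall_compl_eq_zero fun s hs => ?_).symm
          by_contra h
          exact hs (by simpa using (norm_fst_le (s, y)).trans (hR _ h))
      _ ≤ ∫ s in Metric.closedBall (0 : ℝ) R, M :=
          integral_mono (hf.slice y).integrable.integrableOn
            (integrableOn_const measure_closedBall_lt_top.ne) fun s => hM _
      _ = _ := by rw [setIntegral_const, smul_eq_mul, mul_comm]
  · by_contra h
    refine hy ?_
    have : ∀ s, f (s, y) = 0 := fun s => by
      by_contra h'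
      exact h ((norm_snd_le (s, y)).trans (hR _ h'))
    simp [this]

lemma exists_mul_le {f : ℝ → ℝ} (hf : IsTame f) : ∃ C, ∀ s, 0 < s → s * f s ≤ C := by
  obtain ⟨C, hC⟩ := (hf.mul_continuous continuous_abs fun x => abs_nonneg x).exists_le
  exact ⟨C, fun s hs => by simpa [mul_comm, abs_of_pos hs] using hC s⟩

/-- A hyperplane `{x.1 = c}` bisects the mass of a tame function. -/
lemma exists_bisection {f : ℝ × E → ℝ} (hf : IsTame f) :
    ∃ c : ℝ, ∫ x in {x : ℝ × E | c < x.1}, f x = (∫ x, f x) / 2 := by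
  obtain ⟨R, hR⟩ := hf.exists_norm_le
  have hi : Integrable fun s => ∫ y, f (s, y) := hf.integrable.integral_prod_left
  have hnn : 0 ≤ ∫ x, f x := integral_nonneg hf.nonneg
  have hcont : Continuous fun c => ∫ x in {x : ℝ × E | c < x.1}, f x := by
    simp_rw [setIntegral_fst_gt_eq hf.integrable]
    have : (fun c => ∫ s in Set.Ioi c, ∫ y, f (s, y)) =
        fun c => (∫ s in Set.Ioi 0, ∫ y, f (s, y)) - ∫ s in (0)..c, ∫ y, f (s, y) := by
      ext c
      rw [← intervalIntegral.integral_Ioi_sub_Ioi' hi.integrableOn hi.integrableOn]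
      ring
    rw [this]
    exact continuous_const.sub (intervalIntegral.continuous_primitive
      (fun a b => hi.intervalIntegrable) 0)
  have hzero : ∀ x : ℝ × E, R < |x.1| → f x = 0 := fun x hx => by
    by_contra h
    exact absurd ((norm_fst_le x).trans (hR x h)) (not_le.2 hx)
  refine mem_range_of_exists_le_of_exists_ge hcont ⟨|R|, ?_⟩ ⟨-|R| - 1, ?_⟩
  · rw [setIntegral_eq_zero_of_forall_eq_zero]
    · positivity
    · intro x hx
      exact hzero x ((le_abs_self R).trans_lt (lt_of_lt_of_le hx (le_abs_self _)))
  · rw [setIntegral_eq_integral_of_forall_compl_eq_zero]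
    · linarith
    · intro x hx
      have h1 : x.1 ≤ -|R| - 1 := not_lt.1 hx
      refine hzero x ?_
      have := neg_le_abs x.1
      have := le_abs_self R
      linarith

end IsTame

end Product

section Santalo

variable {E : Type*} [NormedAddCommGroup E] [NormedSpace ℝ E] [MeasureSpace E]

/-- The functional Santaló inequality with constant `C` for centered tame functions. -/
def CenteredSantalo (B : E →ₗ[ℝ] E →ₗ[ℝ] ℝ) (C : ℝ) : Prop :=
  ∀ f g : E → ℝ, IsTame f → IsTame g → ∫ x, f x • x = 0 → ∀ K, 0 ≤ K →
    (∀ x y, f x * g y ≤ K * Real.exp (-B x y)) → (∫ x, f x) * (∫ y, g y) ≤ K * C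

/-- The functional Santaló inequality with constant `C` after a suitable translation of the first
function. -/
def TranslatedSantalo (B : E →ₗ[ℝ] E →ₗ[ℝ] ℝ) (C : ℝ) : Prop :=
  ∀ f : E → ℝ, IsTame f → ∃ z, ∀ g : E → ℝ, IsTame g → ∀ K, 0 ≤ K →
    (∀ x y, f (z + x) * g y ≤ K * Real.exp (-B x y)) → (∫ x, f x) * (∫ y, g y) ≤ K * C

/-- The bilinear form `((s, y), (t, z)) ↦ s * t + B y z`. -/
def prodForm (B : E →ₗ[ℝ] E →ₗ[ℝ] ℝ) : ℝ × E →ₗ[ℝ] ℝ × E →ₗ[ℝ] ℝ :=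
  (LinearMap.mul ℝ ℝ).compl₁₂ (LinearMap.fst ℝ ℝ E) (LinearMap.fst ℝ ℝ E) +
    B.compl₁₂ (LinearMap.snd ℝ ℝ E) (LinearMap.snd ℝ ℝ E)

@[simp]
lemma prodForm_apply (B : E →ₗ[ℝ] E →ₗ[ℝ] ℝ) (x y : ℝ × E) :
    prodForm B x y = x.1 * y.1 + B x.2 y.2 := by
  simp [prodForm]

variable [FiniteDimensional ℝ E] [BorelSpace E]

lemma TranslatedSantalo.centered [IsFiniteMeasureOnCompacts (volume : Measure E)]
    {B : E →ₗ[ℝ] E →ₗ[ℝ] ℝ} {C : ℝ} (hB : ∀ x y, B x y = B y x)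
    (h : TranslatedSantalo B C) : CenteredSantalo B C := by
  intro f g hf hg hf0 K hK hfg
  obtain ⟨z, hz⟩ := h g hg
  have hcont : Continuous (B z) := (B z).continuous_of_finiteDimensional
  have htame : IsTame fun x => f x * Real.exp (B z x) :=
    hf.mul_continuous (by fun_prop) fun x => (Real.exp_pos _).le
  have hmain := hz _ htame K hK fun x y => by
    calc g (z + x) * (f y * Real.exp (B z y)) = f y * g (z + x) * Real.exp (B z y) := by ring
      _ ≤ K * Real.exp (-B y (z + x)) * Real.exp (B z y) :=
        mul_le_mul_of_nonneg_right (hfg _ _) (Real.exp_pos _).le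
      _ = K * Real.exp (-B x y) := by
        rw [mul_assoc, ← Real.exp_add, map_add, hB y z, hB y x]
        congr 2
        ring
  have hlin : ∫ x, f x * B z x = 0 := by
    have := (LinearMap.toContinuousLinearMap (B z)).integral_comp_comm
      (hf.integrable_smul continuous_id)
    simpa [hf0] using this
  have hle : ∫ x, f x ≤ ∫ x, f x * Real.exp (B z x) := by
    calc ∫ x, f x = ∫ x, (f x + f x * B z x) := by
          rw [integral_add hf.integrable (by exact hf.integrable_smul hcont), hlin, add_zero]
      _ ≤ _ := by
          refine integral_mono (hf.integrable.add (hf.integrable_smul hcont)) htame.integrable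
            fun x => ?_
          have := Real.add_one_le_exp (B z x)
          have := mul_le_mul_of_nonneg_left this (hf.nonneg x)
          simp only
          linarith
  calc (∫ x, f x) * ∫ y, g y ≤ (∫ x, f x * Real.exp (B z x)) * ∫ y, g y :=
        mul_le_mul_of_nonneg_right hle (integral_nonneg hg.nonneg)
    _ ≤ K * C := by rw [mul_comm]; exact hmain

variable [(volume : Measure E).IsAddHaarMeasure]

/-- The Santaló inequality on a half-space, for a function whose integral along the first
coordinate is centered. -/
lemma CenteredSantalo.halfSpace {B : E →ₗ[ℝ] E →ₗ[ℝ] ℝ} {C : ℝ} (h : CenteredSantalo B C)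
    {f g : ℝ × E → ℝ} (hf : IsTame f) (hg : IsTame g)
    (hf0 : ∫ x in {x : ℝ × E | 0 < x.1}, f x • x.2 = 0) {K : ℝ} (hK : 0 ≤ K)
    (hfg : ∀ x y, f x * g y ≤ K * Real.exp (-prodForm B x y)) :
    (∫ x in {x : ℝ × E | 0 < x.1}, f x) * (∫ x in {x : ℝ × E | 0 < x.1}, g x) ≤
      K * (π / 2) * C := by
  rw [setIntegral_fst_gt_eq_symm hf.integrable, setIntegral_fst_gt_eq_symm hg.integrable]
  refine h _ _ hf.integral_Ioi hg.integral_Ioi ?_ _ (by positivity) fun y y' => ?_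
  · rw [setIntegral_fst_gt_eq_symm (hf.integrable_smul continuous_snd)] at hf0
    simpa only [integral_smul_const] using hf0
  · have := integral_Ioi_mul_integral_Ioi_le (hf.slice y).measurable (hg.slice y').measurable
      (hf.slice y).nonneg (hg.slice y').nonneg (hf.slice y).integrable (hg.slice y').integrable
      (hf.slice y).exists_mul_le (hg.slice y').exists_mul_le
      (K := K * Real.exp (-B y y')) (by positivity) (fun s t _ _ => by
        refine (hfg (s, y) (t, y')).trans_eq ?_
        rw [mul_assoc, ← Real.exp_add, prodForm_apply]
        congr 2
        ring)
    linarith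

/-- A tame function of positive mass can be sheared so that both half-spaces carry half of its mass
and both half-space integrals along the first coordinate are centered. -/
lemma IsTame.exists_shear {f : ℝ × E → ℝ} (hf : IsTame f) (hpos : 0 < ∫ x, f x) :
    ∃ (c : ℝ) (a w : E),
      ∫ x in {x : ℝ × E | 0 < x.1}, f (shear c a w x) = (∫ x, f x) / 2 ∧
      ∫ x in {x : ℝ × E | x.1 < 0}, f (shear c a w x) = (∫ x, f x) / 2 ∧
      ∫ x in {x : ℝ × E | 0 < x.1}, f (shear c a w x) • x.2 = 0 ∧
      ∫ x in {x : ℝ × E | x.1 < 0}, f (shear c a w x) • x.2 = 0 := by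
  obtain ⟨c, hc⟩ := hf.exists_bisection
  have hc' : ∫ x in {x : ℝ × E | x.1 < c}, f x = (∫ x, f x) / 2 := by
    have := integral_eq_setIntegral_gt_add_lt hf.integrable c
    linarith
  have hsplit : ∀ (U : Set (ℝ × E)) (a w : E),
      ∫ x in U, f x • ((shear c a w).symm x).2 = (∫ x in U, f x • x.2) - (∫ x in U, f x) • a -
        (∫ x in U, f x * (x.1 - c)) • w := by
    intro U a w
    have h1 : IntegrableOn (fun x => f x • x.2) U :=
      (hf.integrable_smul continuous_snd).integrableOn
    have h2 : IntegrableOn (fun x => f x • a) U :=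
      (hf.integrable_smul continuous_const).integrableOn
    have h3 : IntegrableOn (fun x => (f x * (x.1 - c)) • w) U :=
      ((hf.integrable_smul (h := fun x : ℝ × E => x.1 - c) (by fun_prop)).smul_const w).integrableOn
    rw [← integral_smul_const, ← integral_smul_const, ← integral_sub h1 h2,
      ← integral_sub (by exact h1.sub h2) h3]
    refine integral_congr_ae (ae_of_all _ fun x => ?_)
    simp [shear, smul_sub, mul_smul]
  set U := {x : ℝ × E | c < x.1}
  set V := {x : ℝ × E | x.1 < c}
  have hint : Integrable (fun x : ℝ × E => f x * (x.1 - c)) :=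
    hf.integrable_smul (h := fun x : ℝ × E => x.1 - c) (by fun_prop)
  have hS : 0 < ∫ x in U, f x * (x.1 - c) := by
    have hnn : 0 ≤ᵐ[volume.restrict U] fun x => f x * (x.1 - c) :=
      (ae_restrict_iff' (measurableSet_fst_gt c)).2 (ae_of_all _ fun x hx =>
        mul_nonneg (hf.nonneg x) (sub_nonneg.2 (le_of_lt hx)))
    refine lt_of_le_of_ne (integral_nonneg_of_ae hnn) fun h0 => ?_
    have h1 := (integral_eq_zero_iff_of_nonneg_ae hnn hint.integrableOn).1 h0.symm
    have h2 : ∫ x in U, f x = 0 := by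
      refine integral_eq_zero_of_ae ?_
      filter_upwards [h1, ae_restrict_mem (measurableSet_fst_gt c)] with x hx hxU
      exact (mul_eq_zero.1 hx).resolve_right (sub_pos.2 hxU).ne'
    linarith
  have hS' : ∫ x in V, f x * (x.1 - c) ≤ 0 :=
    setIntegral_nonpos (measurableSet_fst_lt c) fun x hx =>
      mul_nonpos_of_nonneg_of_nonpos (hf.nonneg x) (sub_nonpos.2 (le_of_lt hx))
  set S := ∫ x in U, f x * (x.1 - c)
  set S' := ∫ x in V, f x * (x.1 - c)
  set Y := ∫ x in U, f x • x.2
  set Y' := ∫ x in V, f x • x.2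
  set m := (∫ x, f x) / 2
  have hm : m ≠ 0 := by positivity
  have hSS : S - S' ≠ 0 := by linarith
  let w : E := (S - S')⁻¹ • (Y - Y')
  let a : E := m⁻¹ • (Y - S • w)
  have ha : m • a = Y - S • w := smul_inv_smul₀ hm _
  have hw : S • w - S' • w = Y - Y' := by rw [← sub_smul]; exact smul_inv_smul₀ hSS _
  refine ⟨c, a, w, (setIntegral_shear_gt c a w f).trans hc, 
    (setIntegral_shear_lt c a w f).trans hc', ?_, ?_⟩
  · have := setIntegral_shear_gt c a w fun x => f x • ((shear c a w).symm x).2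
    simp only [Homeomorph.symm_apply_apply] at this
    rw [this, hsplit, hc, ha]
    abel
  · have := setIntegral_shear_lt c a w fun x => f x • ((shear c a w).symm x).2
    simp only [Homeomorph.symm_apply_apply] at this
    rw [this, hsplit, hc', ha]
    have : Y' = Y - (S • w - S' • w) := by rw [hw]; abel
    change Y' - _ - _ = _
    rw [this]
    abel

lemma CenteredSantalo.translated_prod {B : E →ₗ[ℝ] E →ₗ[ℝ] ℝ} {C : ℝ}
    (h : CenteredSantalo B C) (hC : 0 ≤ C) : TranslatedSantalo (prodForm B) (2 * π * C) := by
  intro f hf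
  rcases (integral_nonneg hf.nonneg : 0 ≤ ∫ x, f x).eq_or_lt' with h0 | hpos
  · refine ⟨0, fun g _ K hK _ => ?_⟩
    rw [h0, zero_mul]
    positivity
  obtain ⟨c, a, w, hm, hm', h0, h0'⟩ := hf.exists_shear hpos
  refine ⟨(c, a), fun g hg K hK hfg => ?_⟩
  have hf1 := hf.comp_homeomorph (shear c a w)
  have hg1 := hg.comp_homeomorph (dualShear (B w))
  have hfg1 : ∀ x y, f (shear c a w x) * g (dualShear (B w) y) ≤
      K * Real.exp (-prodForm B x y) := fun x y => by
    have h1 := hfg (x.1, x.2 + x.1 • w) (dualShear (B w) y)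
    have e1 : (c, a) + (x.1, x.2 + x.1 • w) = shear c a w x := by
      simp [shear, add_assoc]
    have e2 : prodForm B (x.1, x.2 + x.1 • w) (dualShear (B w) y) = prodForm B x y := by
      simp [dualShear]
      ring
    rwa [e1, e2] at h1
  have key := h.halfSpace hf1 hg1 h0 hK hfg1
  have key' := h.halfSpace (hf1.comp_homeomorph (reflectFst E))
    (hg1.comp_homeomorph (reflectFst E)) (by
      rw [setIntegral_fst_lt_zero_eq] at h0'
      simpa [reflectFst] using h0') hK (fun x y => by
      refine (hfg1 _ _).trans_eq ?_
      simp [reflectFst])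
  rw [← setIntegral_fst_lt_zero_eq fun x => f (shear c a w x),
    ← setIntegral_fst_lt_zero_eq fun x => g (dualShear (B w) x), hm'] at key'
  rw [hm] at key
  have hgi : ∫ y, g y = ∫ y, g (dualShear (B w) y) :=
    ((measurePreserving_dualShear (B w)).integral_comp
      (dualShear (B w)).measurableEmbedding g).symm
  rw [hgi, integral_eq_setIntegral_gt_add_lt hg1.integrable 0]
  linarith

end Santalo

section Induction

lemma CenteredSantalo.of_measurePreserving {E E' : Type*}
    [NormedAddCommGroup E] [NormedSpace ℝ E] [FiniteDimensional ℝ E] [MeasureSpace E] [BorelSpace E]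
    [NormedAddCommGroup E'] [NormedSpace ℝ E'] [FiniteDimensional ℝ E'] [MeasureSpace E']
    [BorelSpace E'] [IsFiniteMeasureOnCompacts (volume : Measure E')]
    {B : E →ₗ[ℝ] E →ₗ[ℝ] ℝ} {B' : E' →ₗ[ℝ] E' →ₗ[ℝ] ℝ} {C : ℝ} (h : CenteredSantalo B C)
    (e : E ≃L[ℝ] E') (he : MeasurePreserving e) (hB : ∀ x y, B x y = B' (e x) (e y)) :
    CenteredSantalo B' C := by
  intro f g hf hg hf0 K hK hfg
  have hemb : MeasurableEmbedding e := e.toHomeomorph.measurableEmbedding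
  have key := h (fun x => f (e x)) (fun x => g (e x)) (hf.comp_homeomorph e.toHomeomorph)
    (hg.comp_homeomorph e.toHomeomorph) ?_ K hK fun x y => by rw [hB]; exact hfg _ _
  · rwa [he.integral_comp hemb, he.integral_comp hemb] at key
  · have h1 := he.integral_comp hemb fun x => f x • e.symm x
    have h2 := (e.symm : E' →L[ℝ] E).integral_comp_comm (hf.integrable_smul continuous_id)
    simp only [ContinuousLinearEquiv.symm_apply_apply] at h1
    rw [h1]
    simpa [hf0] using h2

lemma centeredSantalo_dotProduct (n : ℕ) :
    CenteredSantalo (dotProductBilin ℝ ℝ : (Fin n → ℝ) →ₗ[ℝ] (Fin n → ℝ) →ₗ[ℝ] ℝ)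
      ((2 * π) ^ n) := by
  induction n with
  | zero =>
    intro f g _ _ _ K _ hfg
    have := hfg 0 0
    simpa [volume_pi, Measure.pi_of_empty _ (0 : Fin 0 → ℝ)] using this
  | succ n ih =>
    have h := (ih.translated_prod (by positivity)).centered fun x y => by
      simp [mul_comm, dotProduct_comm]
    rw [pow_succ']
    refine h.of_measurePreserving (Fin.consEquivL ℝ fun _ : Fin (n + 1) => ℝ) ?_ fun x y => ?_
    · have hcons : ⇑(Fin.consEquivL ℝ fun _ : Fin (n + 1) => ℝ) =
          (MeasurableEquiv.piFinSuccAbove (fun _ : Fin (n + 1) => ℝ) 0).symm := by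
        ext x i
        refine Fin.cases ?_ (fun j => ?_) i <;> simp [MeasurableEquiv.piFinSuccAbove]
      rw [hcons]
      exact (volume_preserving_piFinSuccAbove (fun _ : Fin (n + 1) => ℝ) 0).symm _
    · simp [dotProduct, Fin.sum_univ_succ]

lemma centeredSantalo_inner (n : ℕ) :
    CenteredSantalo (innerₗ (EuclideanSpace ℝ (Fin n))) ((2 * π) ^ n) := by
  refine (centeredSantalo_dotProduct n).of_measurePreserving
    (EuclideanSpace.equiv (Fin n) ℝ).symm (PiLp.volume_preserving_toLp (Fin n)) fun x y => ?_
  simp [PiLp.inner_apply, dotProduct, mul_comm]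

end Induction

section Gaussian

/-- Even functional Santaló inequality for locally bounded functions. -/
lemma lintegral_mul_lintegral_le_of_even {d : ℕ} {φ ψ : EuclideanSpace ℝ (Fin d) → ℝ}
    (hφ : Measurable φ) (hψ : Measurable ψ) (hφ0 : ∀ x, 0 ≤ φ x) (hψ0 : ∀ x, 0 ≤ ψ x)
    (hφb : ∀ R, ∃ M, ∀ x, ‖x‖ ≤ R → φ x ≤ M) (hψb : ∀ R, ∃ M, ∀ x, ‖x‖ ≤ R → ψ x ≤ M)
    (heven : ∀ x, φ (-x) = φ x) (hφψ : ∀ x y, φ x * ψ y ≤ Real.exp (-inner ℝ x y)) :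
    (∫⁻ x, ENNReal.ofReal (φ x)) * (∫⁻ x, ENNReal.ofReal (ψ x)) ≤
      ENNReal.ofReal ((2 * π) ^ d) := by
  let b : ℕ → Set (EuclideanSpace ℝ (Fin d)) := fun n => Metric.closedBall 0 n
  have hb : ∀ n, MeasurableSet (b n) := fun n => measurableSet_closedBall
  have tame : ∀ {φ : EuclideanSpace ℝ (Fin d) → ℝ}, Measurable φ → (∀ x, 0 ≤ φ x) →
      (∀ R, ∃ M, ∀ x, ‖x‖ ≤ R → φ x ≤ M) → ∀ n, IsTame ((b n).indicator φ) := by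
    intro φ h1 h2 h3 n
    obtain ⟨M, hM⟩ := h3 n
    refine ⟨h1.indicator (hb n), Set.indicator_nonneg fun x _ => h2 x, ⟨M, fun x => ?_⟩,
      ⟨n, fun x hx => by simpa [b] using Set.mem_of_indicator_ne_zero hx⟩⟩
    refine Set.indicator_apply_le' (fun hx => hM x (by simpa [b] using hx)) fun _ => ?_
    exact (h2 0).trans (hM 0 (by simp))
  have lint : ∀ {φ : EuclideanSpace ℝ (Fin d) → ℝ}, Measurable φ → (∀ x, 0 ≤ φ x) →
      (∀ R, ∃ M, ∀ x, ‖x‖ ≤ R → φ x ≤ M) → ∀ n,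
      ∫⁻ x in b n, ENNReal.ofReal (φ x) = ENNReal.ofReal (∫ x, (b n).indicator φ x) := by
    intro φ h1 h2 h3 n
    have ht := tame h1 h2 h3 n
    rw [ofReal_integral_eq_lintegral_ofReal ht.integrable (ae_of_all _ ht.nonneg),
      ← lintegral_indicator (hb n)]
    congr 1
    ext x
    by_cases hx : x ∈ b n <;> simp [hx]
  have sup : ∀ φ : EuclideanSpace ℝ (Fin d) → ℝ,
      ∫⁻ x, ENNReal.ofReal (φ x) = ⨆ n, ∫⁻ x in b n, ENNReal.ofReal (φ x) := by
    intro φ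
    rw [← setLIntegral_iUnion_of_directed, Metric.iUnion_closedBall_nat, setLIntegral_univ]
    refine Monotone.directed_le (f := b) fun m n hmn => ?_
    exact Metric.closedBall_subset_closedBall (by exact_mod_cast hmn)
  rw [sup φ, sup ψ, ENNReal.iSup_mul]
  refine iSup_le fun m => ?_
  rw [ENNReal.mul_iSup]
  refine iSup_le fun n => ?_
  have h1 := tame hφ hφ0 hφb m
  have h2 := tame hψ hψ0 hψb n
  rw [lint hφ hφ0 hφb, lint hψ hψ0 hψb, ← ENNReal.ofReal_mul (integral_nonneg h1.nonneg)]
  refine ENNReal.ofReal_le_ofReal ?_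
  have hcenter : ∫ x, (b m).indicator φ x • x = 0 := by
    have hodd : ∀ x, (b m).indicator φ (-x) • (-x) = -((b m).indicator φ x • x) := fun x => by
      have : (b m).indicator φ (-x) = (b m).indicator φ x := by
        simp [Set.indicator, b, heven]
      rw [this, smul_neg]
    have h3 := integral_neg_eq_self (fun x => (b m).indicator φ x • x) volume
    simp only [hodd, integral_neg] at h3
    have := IsAddTorsionFree.of_module_rat (EuclideanSpace ℝ (Fin d))
    exact self_eq_neg.1 h3.symm
  have := centeredSantalo_inner d _ _ h1 h2 hcenter 1 zero_le_one fun x y => by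
    rw [one_mul, innerₗ_apply_apply]
    refine le_trans ?_ (hφψ x y)
    exact mul_le_mul (Set.indicator_le_self' (fun x _ => hφ0 x) x)
      (Set.indicator_le_self' (fun x _ => hψ0 x) y) (h2.nonneg y) (hφ0 x)
  simpa using this

variable {E : Type*} [NormedAddCommGroup E]

lemma bddBelow_range_add_norm_sq {f : E → ℝ} (hf : BddBelow (Set.range f)) (x : E) :
    BddBelow (Set.range fun y => f (x + y) + ‖y‖ ^ 2 / 2) := by
  obtain ⟨m, hm⟩ := hf
  refine ⟨m, ?_⟩
  rintro _ ⟨y, rfl⟩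
  have := hm ⟨x + y, rfl⟩
  have : 0 ≤ ‖y‖ ^ 2 / 2 := by positivity
  simp only
  linarith

lemma Hconv_le {f : E → ℝ} (hf : BddBelow (Set.range f)) (x y : E) :
    Hconv f x ≤ f (x + y) + ‖y‖ ^ 2 / 2 :=
  ciInf_le (bddBelow_range_add_norm_sq hf x) y

lemma measurable_Hconv [MeasurableSpace E] [BorelSpace E] {f : E → ℝ} (hfc : Continuous f)
    (hf : BddBelow (Set.range f)) : Measurable (Hconv f) := by
  refine UpperSemicontinuous.measurable ?_
  refine upperSemicontinuous_ciInf (bddBelow_range_add_norm_sq hf) fun y => ?_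
  exact Continuous.upperSemicontinuous (by fun_prop)

/-- Infimal convolution is compatible with composition by a `1`-Lipschitz map. -/
lemma Hconv_apply_le_Hconv_comp {f : E → ℝ} (hf : BddBelow (Set.range f)) {T : E → E}
    (hT : LipschitzWith 1 T) (x : E) : Hconv f (T x) ≤ Hconv (fun y => f (T y)) x := by
  refine le_ciInf fun y => ?_
  have h1 := Hconv_le hf (T x) (T (x + y) - T x)
  rw [add_sub_cancel] at h1
  have h2 : ‖T (x + y) - T x‖ ≤ ‖y‖ := by
    simpa [dist_eq_norm] using hT.dist_le_mul (x + y) x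
  have h3 : ‖T (x + y) - T x‖ ^ 2 ≤ ‖y‖ ^ 2 := by gcongr
  linarith

lemma lintegral_stdGauss {d : ℕ} {h : EuclideanSpace ℝ (Fin d) → ℝ} (hh : Measurable h) :
    ∫⁻ x, ENNReal.ofReal (Real.exp (h x)) ∂stdGauss d =
      ENNReal.ofReal ((2 * π) ^ (-(d : ℝ) / 2)) *
        ∫⁻ x, ENNReal.ofReal (Real.exp (h x - ‖x‖ ^ 2 / 2)) := by
  rw [stdGauss, lintegral_withDensity_eq_lintegral_mul _ (by fun_prop) (by fun_prop),
    ← lintegral_const_mul _ (by fun_prop)]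
  refine lintegral_congr fun x => ?_
  rw [Pi.mul_apply, ← ENNReal.ofReal_mul (by positivity), ← ENNReal.ofReal_mul (by positivity),
    mul_assoc, ← Real.exp_add]
  congr 3
  ring

/-- The symmetric property (τ) of the Gaussian measure. -/
lemma symmetric_tau_stdGauss {d : ℕ} {f : EuclideanSpace ℝ (Fin d) → ℝ}
    (hfc : Continuous f) (hfb : BddBelow (Set.range f)) (hfe : ∀ x, f (-x) = f x) :
    (∫⁻ x, ENNReal.ofReal (Real.exp (-f x)) ∂stdGauss d) *
      (∫⁻ x, ENNReal.ofReal (Real.exp (Hconv f x)) ∂stdGauss d) ≤ 1 := by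
  have hH := measurable_Hconv hfc hfb
  have exists_bound : ∀ {h : EuclideanSpace ℝ (Fin d) → ℝ}, Continuous h →
      ∀ R, ∃ M, ∀ x, ‖x‖ ≤ R → h x ≤ M := fun {h} hc R => by
    obtain ⟨M, hM⟩ := (isCompact_closedBall (0 : EuclideanSpace ℝ (Fin d)) R)
      |>.exists_bound_of_continuousOn hc.continuousOn
    exact ⟨M, fun x hx => (le_abs_self _).trans (hM x (by simpa using hx))⟩
  have key := lintegral_mul_lintegral_le_of_even
    (φ := fun x => Real.exp (-f x - ‖x‖ ^ 2 / 2)) (ψ := fun x => Real.exp (Hconv f x - ‖x‖ ^ 2 / 2))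
    (by fun_prop) (by fun_prop) (fun x => (Real.exp_pos _).le) (fun x => (Real.exp_pos _).le)
    (exists_bound (by fun_prop)) (fun R => ?_) (fun x => by simp [hfe]) (fun x y => ?_)
  · rw [lintegral_stdGauss (by fun_prop), lintegral_stdGauss hH, mul_mul_mul_comm]
    refine (mul_le_mul_right key _).trans ?_
    rw [← ENNReal.ofReal_mul (by positivity), ← ENNReal.ofReal_mul (by positivity),
      ← Real.rpow_natCast, ← Real.rpow_add (by positivity), ← Real.rpow_add (by positivity)]
    simp
  · obtain ⟨M, hM⟩ := exists_bound (h := fun x => Real.exp (f x)) (by fun_prop) R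
    refine ⟨M, fun x hx => le_trans (Real.exp_le_exp.2 ?_) (hM x hx)⟩
    have := Hconv_le hfb x 0
    have : 0 ≤ ‖x‖ ^ 2 / 2 := by positivity
    simp at *
    linarith
  · rw [← Real.exp_add]
    refine Real.exp_le_exp.2 ?_
    have h1 := Hconv_le hfb y (x - y)
    rw [add_sub_cancel, norm_sub_sq_real] at h1
    linarith

end Gaussian

/-- The symmetric property (τ) is stable under pushforward by a 1-Lipschitz odd map:
if `μ = T_*γ_d` with `T` 1-Lipschitz and odd, then for every continuous, bounded
from below, even `f`, `(∫ e^{-f} dμ) (∫ e^{Hf} dμ) ≤ 1`. -/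
theorem symmetric_tau_pushforward (d : ℕ)
    (T : EuclideanSpace ℝ (Fin d) → EuclideanSpace ℝ (Fin d))
    (hT_lip : LipschitzWith 1 T) (hT_odd : ∀ x, T (-x) = -T x)
    (f : EuclideanSpace ℝ (Fin d) → ℝ)
    (hf_cont : Continuous f) (hf_bdd : BddBelow (Set.range f))
    (hf_even : ∀ x, f (-x) = f x) :
    (∫⁻ x, ENNReal.ofReal (Real.exp (-f x)) ∂Measure.map T (stdGauss d)) *
      (∫⁻ x, ENNReal.ofReal (Real.exp (Hconv f x)) ∂Measure.map T (stdGauss d)) ≤ 1 := by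
  refine le_trans (mul_le_mul' (lintegral_map_le _ _) ((lintegral_map_le _ _).trans ?_))
    (symmetric_tau_stdGauss (hf_cont.comp hT_lip.continuous)
      (hf_bdd.mono (Set.range_comp_subset_range T f)) fun x => by simp [hT_odd, hf_even])
  exact lintegral_mono fun x => ENNReal.ofReal_le_ofReal
    (Real.exp_le_exp.2 (Hconv_apply_le_Hconv_comp hf_bdd hT_lip x))
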